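/- Multiplicative Horn problem in U(2): For τ = ((α₁,α₂),(β₁,β₂),(γ₁,γ₂)) ∈ 𝒯³ there exist A, B, C ∈ U(2) such that A is conjugate by an element of U(2) to diag(e^{iα₁}, e^{iα₂}), B to diag(e^{iβ₁}, e^{iβ₂}), C to diag(e^{iγ₁}, e^{iγ₂}), and A·B·C = I₂, if and only if τ belongs to C₀ ∪ C₂π ∪ C₄π ∪ C₆π ∪ C₈π, where (all intersected with 𝒯³): C₀ = {S = 0}; C₂π = {S = 2π, σ₂₂₂ ≤ 0, σ₁₁₂ ≤ 2π, σ₁₂₁ ≤ 2π, σ₂₁₁ ≤ 2π}; C₄π = {S = 4π, σ₁₁₁ ≤ 4π, σ₁₂₂ ≤ 2π, σ₂₁₂ ≤ 2π, σ₂₂₁ ≤ 2π}; C₆π = {S = 6π, σ₂₂₂ ≤ 2π, σ₁₁₂ ≤ 4π, σ₁₂₁ ≤ 4π, σ₂₁₁ ≤ 4π}; C₈π = {S = 8π, σ₁₁₁ ≤ 6π, σ₁₂₂ ≤ 4π, σ₂₁₂ ≤ 4π, σ₂₂₁ ≤ 4π}. -/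

import Mathlib

open Real Matrix

noncomputable section

abbrev Pt : Type := ℝ × ℝ
abbrev Tri : Type := Pt × Pt × Pt

/-- The triangle `𝒯 = {(a₁,a₂) ∈ [0,2π)² : a₁ ≥ a₂}`. -/
def memT (p : Pt) : Prop :=
  0 ≤ p.1 ∧ p.1 < 2 * π ∧ 0 ≤ p.2 ∧ p.2 < 2 * π ∧ p.2 ≤ p.1

def memT3 (τ : Tri) : Prop := memT τ.1 ∧ memT τ.2.1 ∧ memT τ.2.2

abbrev M2 : Type := Matrix (Fin 2) (Fin 2) ℂ

/-- Membership in the unitary group U(2). -/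
def memU2 (M : M2) : Prop := Mᴴ * M = 1

/-- The diagonal matrix diag(e^{ia₁}, e^{ia₂}). -/
def D2 (a₁ a₂ : ℝ) : M2 :=
  Matrix.diagonal ![Complex.exp (a₁ * Complex.I), Complex.exp (a₂ * Complex.I)]

/-- `M` is conjugate by an element of U(2) to diag(e^{ia₁}, e^{ia₂}). -/
def conjU2 (M : M2) (a₁ a₂ : ℝ) : Prop :=
  ∃ P : M2, memU2 P ∧ M = P * D2 a₁ a₂ * P⁻¹

lemma memU2_inv {P : M2} (h : memU2 P) : P⁻¹ = Pᴴ := Matrix.inv_eq_left_inv h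

lemma memU2_right {P : M2} (h : memU2 P) : P * Pᴴ = 1 := mul_eq_one_comm.mp h

lemma D2_mul (a b c d : ℝ) : D2 a b * D2 c d = D2 (a + c) (b + d) := by
  unfold D2
  rw [Matrix.diagonal_mul_diagonal]
  congr 1
  funext i
  fin_cases i <;> simp [← Complex.exp_add] <;> ring_nf

lemma D2_zero : D2 0 0 = 1 := by
  ext i j
  fin_cases i <;> fin_cases j <;> simp [D2]

lemma D2_star (a b : ℝ) : (D2 a b)ᴴ = D2 (-a) (-b) := by
  ext i j
  fin_cases i <;> fin_cases j <;> simp [D2, ← Complex.exp_conj]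

lemma D2_memU2 (a b : ℝ) : memU2 (D2 a b) := by
  unfold memU2
  rw [D2_star, D2_mul]
  simp [D2_zero]

lemma memU2_mul {P Q : M2} (hP : memU2 P) (hQ : memU2 Q) : memU2 (P * Q) := by
  unfold memU2 at *
  rw [Matrix.conjTranspose_mul]
  calc Qᴴ * Pᴴ * (P * Q) = Qᴴ * (Pᴴ * P) * Q := by simp only [Matrix.mul_assoc]
    _ = 1 := by rw [hP]; simpa using hQ

lemma memU2_star {P : M2} (hP : memU2 P) : memU2 Pᴴ := by
  unfold memU2
  rw [Matrix.conjTranspose_conjTranspose]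
  exact memU2_right hP

lemma D2_det (a b : ℝ) : (D2 a b).det = Complex.exp ((a + b : ℝ) * Complex.I) := by
  simp [D2, Matrix.det_diagonal, ← Complex.exp_add]
  ring_nf

/-- trace formula -/
lemma trace_formula (a₁ a₂ b₁ b₂ : ℝ) (U : M2) (hU : memU2 U) :
    (D2 a₁ a₂ * U * D2 b₁ b₂ * Uᴴ).trace =
      (Complex.normSq (U 0 0) : ℂ) * (Complex.exp ((a₁ + b₁ : ℝ) * Complex.I)
        + Complex.exp ((a₂ + b₂ : ℝ) * Complex.I))
      + (1 - (Complex.normSq (U 0 0) : ℂ)) * (Complex.exp ((a₁ + b₂ : ℝ) * Complex.I)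
        + Complex.exp ((a₂ + b₁ : ℝ) * Complex.I)) := by
  have h1 := memU2_right hU
  have h2 : Uᴴ * U = 1 := hU
  have e1 := congrFun (congrFun h1 0) 0
  have e2 := congrFun (congrFun h1 1) 1
  have e3 := congrFun (congrFun h2 0) 0
  simp [Matrix.mul_apply, Fin.sum_univ_two] at e1 e2 e3
  have q : (Complex.normSq (U 0 0) : ℂ) = U 0 0 * (starRingEnd ℂ) (U 0 0) :=
    (Complex.mul_conj _).symm
  simp only [q]
  simp [Matrix.trace, Matrix.mul_apply, Fin.sum_univ_two, D2, Matrix.diagonal_apply,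
    add_mul, Complex.exp_add]
  generalize Complex.exp (a₁ * Complex.I) = x1
  generalize Complex.exp (a₂ * Complex.I) = x2
  generalize Complex.exp (b₁ * Complex.I) = y1
  generalize Complex.exp (b₂ * Complex.I) = y2
  generalize U 0 0 = u at *
  generalize U 0 1 = v at *
  generalize U 1 0 = w at *
  generalize U 1 1 = z at *
  linear_combination (x1 * y2) * e1 + x2 * y2 * (e2 - e3) + x2 * y1 * e3

lemma normSq_le_one (U : M2) (hU : memU2 U) : Complex.normSq (U 0 0) ≤ 1 := by
  have h2 : Uᴴ * U = 1 := hU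
  have e3 := congrFun (congrFun h2 0) 0
  simp [Matrix.mul_apply, Fin.sum_univ_two] at e3
  rw [mul_comm, Complex.mul_conj, mul_comm, Complex.mul_conj] at e3
  have : Complex.normSq (U 0 0) + Complex.normSq (U 1 0) = 1 := by exact_mod_cast e3
  have := Complex.normSq_nonneg (U 1 0)
  linarith

/-- A unitary matrix with the right trace and determinant is conjugate to the diagonal. -/
lemma conjU2_of_trace_det (C : M2) (hC : memU2 C) (g₁ g₂ : ℝ)
    (ht : C.trace = Complex.exp (g₁ * Complex.I) + Complex.exp (g₂ * Complex.I))
    (hd : C.det = Complex.exp (g₁ * Complex.I) * Complex.exp (g₂ * Complex.I)) :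
    conjU2 C g₁ g₂ := by
  set l := Complex.exp (g₁ * Complex.I) with hl
  set m := Complex.exp (g₂ * Complex.I) with hm
  have hl0 : l ≠ 0 := Complex.exp_ne_zero _
  rw [Matrix.trace_fin_two] at ht
  rw [Matrix.det_fin_two] at hd
  have hdet : (C - l • (1 : M2)).det = 0 := by
    rw [Matrix.det_fin_two]
    simp
    linear_combination hd - l * ht
  obtain ⟨v, hv0, hv⟩ := Matrix.exists_mulVec_eq_zero_iff.mpr hdet
  have hv1 := congrFun hv 0
  have hv2 := congrFun hv 1
  simp [Matrix.mulVec, dotProduct, Fin.sum_univ_two] at hv1 hv2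
  -- normalise
  set N : ℝ := Complex.normSq (v 0) + Complex.normSq (v 1) with hN
  have hNpos : 0 < N := by
    by_contra hcon
    have a0 := Complex.normSq_nonneg (v 0)
    have a1 := Complex.normSq_nonneg (v 1)
    apply hv0
    funext i
    fin_cases i
    · exact (Complex.normSq_eq_zero (z := v 0)).mp (by linarith)
    · exact (Complex.normSq_eq_zero (z := v 1)).mp (by linarith)
  obtain ⟨x, y, hxy, hx, hy⟩ : ∃ x y : ℂ, (starRingEnd ℂ x) * x + (starRingEnd ℂ y) * y = 1 ∧
      C 0 0 * x + C 0 1 * y = l * x ∧ C 1 0 * x + C 1 1 * y = l * y := by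
    have hs : ((√N : ℝ) : ℂ) ≠ 0 := by
      exact_mod_cast (Real.sqrt_pos.mpr hNpos).ne'
    have hss : ((√N : ℝ) : ℂ) * ((√N : ℝ) : ℂ) = N := by
      exact_mod_cast Real.mul_self_sqrt hNpos.le
    have hNc : (starRingEnd ℂ (v 0)) * v 0 + (starRingEnd ℂ (v 1)) * v 1 = N := by
      rw [mul_comm, Complex.mul_conj, mul_comm, Complex.mul_conj, hN]; push_cast; rfl
    refine ⟨v 0 / (√N : ℝ), v 1 / (√N : ℝ), ?_, ?_, ?_⟩
    · simp only [map_div₀, Complex.conj_ofReal]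
      field_simp
      rw [pow_two, hss, ← hNc]
      try ring
    · field_simp
      linear_combination hv1
    · field_simp
      linear_combination hv2
  let P : M2 := !![x, -(starRingEnd ℂ y); y, starRingEnd ℂ x]
  have hP : memU2 P := by
    unfold memU2
    ext i j
    fin_cases i <;> fin_cases j <;> simp [P, Matrix.mul_apply, Fin.sum_univ_two]
    · linear_combination hxy
    · ring
    · ring
    · linear_combination hxy
  refine ⟨P, hP, ?_⟩
  rw [memU2_inv hP]
  set T : M2 := Pᴴ * C * P with hT
  have hTU : memU2 T := memU2_mul (memU2_mul (memU2_star hP) hC) hP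
  have hCT : C = P * T * Pᴴ := by
    have := memU2_right hP
    rw [hT]
    calc C = (P * Pᴴ) * C * (P * Pᴴ) := by rw [this]; simp
      _ = _ := by simp only [Matrix.mul_assoc]
  have t00 : T 0 0 = l := by
    simp [hT, P, Matrix.mul_apply, Fin.sum_univ_two]
    linear_combination (starRingEnd ℂ x) * hx + (starRingEnd ℂ y) * hy + l * hxy
  have t10 : T 1 0 = 0 := by
    simp [hT, P, Matrix.mul_apply, Fin.sum_univ_two]
    linear_combination -y * hx + x * hy
  have t01 : T 0 1 = 0 := by
    have h2 : Tᴴ * T = 1 := hTU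
    have e := congrFun (congrFun h2 0) 1
    simp [Matrix.mul_apply, Fin.sum_univ_two, t00, t10] at e
    rcases e with e | e
    · exact absurd e hl0
    · exact e
  have ttr : T.trace = l + m := by
    rw [← ht, ← Matrix.trace_fin_two, hT, Matrix.mul_assoc, Matrix.trace_mul_comm,
      Matrix.mul_assoc, memU2_right hP, Matrix.mul_one]
  have t11 : T 1 1 = m := by
    rw [Matrix.trace_fin_two, t00] at ttr
    linear_combination ttr
  have hTD : T = D2 g₁ g₂ := by
    ext i j
    fin_cases i <;> fin_cases j <;> simp [D2, t00, t01, t10, t11, hl, hm]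
  rw [← hTD]
  exact hCT

/-- The scalar condition. -/
def traceCond (α₁ α₂ β₁ β₂ γ₁ γ₂ t : ℝ) : Prop :=
  (t : ℂ) * (Complex.exp ((α₁ + β₁ : ℝ) * Complex.I)
        + Complex.exp ((α₂ + β₂ : ℝ) * Complex.I))
      + (1 - (t : ℂ)) * (Complex.exp ((α₁ + β₂ : ℝ) * Complex.I)
        + Complex.exp ((α₂ + β₁ : ℝ) * Complex.I))
    = Complex.exp ((-γ₁ : ℝ) * Complex.I) + Complex.exp ((-γ₂ : ℝ) * Complex.I)

lemma conj_trace (P D : M2) (hP : memU2 P) : (P * D * Pᴴ).trace = D.trace := by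
  rw [Matrix.trace_mul_comm, ← Matrix.mul_assoc]
  rw [show Pᴴ * P = 1 from hP, Matrix.one_mul]

lemma conj_det (P D : M2) (hP : memU2 P) : (P * D * Pᴴ).det = D.det := by
  rw [Matrix.det_mul_comm, ← Matrix.mul_assoc]
  rw [show Pᴴ * P = 1 from hP, Matrix.one_mul]

lemma D2_trace (a b : ℝ) : (D2 a b).trace =
    Complex.exp (a * Complex.I) + Complex.exp (b * Complex.I) := by
  simp [D2, Matrix.trace_fin_two]

lemma horn_scalar_iff (α₁ α₂ β₁ β₂ γ₁ γ₂ : ℝ) :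
    (∃ A B C : M2, memU2 A ∧ memU2 B ∧ memU2 C ∧
        conjU2 A α₁ α₂ ∧ conjU2 B β₁ β₂ ∧ conjU2 C γ₁ γ₂ ∧ A * B * C = 1) ↔
    (Complex.exp ((α₁ + α₂ + β₁ + β₂ + γ₁ + γ₂ : ℝ) * Complex.I) = 1 ∧
      ∃ t : ℝ, 0 ≤ t ∧ t ≤ 1 ∧ traceCond α₁ α₂ β₁ β₂ γ₁ γ₂ t) := by
  constructor
  · rintro ⟨A, B, C, -, -, -, ⟨P, hP, rfl⟩, ⟨Q, hQ, rfl⟩, ⟨R, hR, rfl⟩, h⟩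
    rw [memU2_inv hP, memU2_inv hQ, memU2_inv hR] at h
    constructor
    · have := congrArg Matrix.det h
      rw [Matrix.det_mul, Matrix.det_mul, conj_det _ _ hP, conj_det _ _ hQ, conj_det _ _ hR,
        D2_det, D2_det, D2_det, Matrix.det_one, ← Complex.exp_add, ← Complex.exp_add] at this
      rw [← this]
      congr 1
      push_cast
      ring
    · have hU : memU2 (Pᴴ * Q) := memU2_mul (memU2_star hP) hQ
      refine ⟨Complex.normSq ((Pᴴ * Q) 0 0), Complex.normSq_nonneg _, normSq_le_one _ hU, ?_⟩
      unfold traceCond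
      rw [← trace_formula _ _ _ _ _ hU, ← D2_trace, ← conj_trace R (D2 (-γ₁) (-γ₂)) hR]
      have h3 : (R * D2 γ₁ γ₂ * Rᴴ) * (R * D2 (-γ₁) (-γ₂) * Rᴴ) = 1 := by
        calc (R * D2 γ₁ γ₂ * Rᴴ) * (R * D2 (-γ₁) (-γ₂) * Rᴴ)
            = R * D2 γ₁ γ₂ * (Rᴴ * R) * D2 (-γ₁) (-γ₂) * Rᴴ := by
              simp only [Matrix.mul_assoc]
          _ = R * (D2 γ₁ γ₂ * D2 (-γ₁) (-γ₂)) * Rᴴ := by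
              rw [show Rᴴ * R = 1 from hR, Matrix.mul_one]; simp only [Matrix.mul_assoc]
          _ = 1 := by
              rw [D2_mul, add_neg_cancel, add_neg_cancel, D2_zero, Matrix.mul_one,
                memU2_right hR]
      have h4 := left_inv_eq_right_inv h h3
      rw [← h4, Matrix.conjTranspose_mul, Matrix.conjTranspose_conjTranspose]
      rw [show P * D2 α₁ α₂ * Pᴴ * (Q * D2 β₁ β₂ * Qᴴ) =
        P * (D2 α₁ α₂ * Pᴴ * Q * D2 β₁ β₂ * Qᴴ) by simp only [Matrix.mul_assoc],
        Matrix.trace_mul_comm P]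
      simp only [Matrix.mul_assoc]
  · rintro ⟨hS, t, ht0, ht1, ht⟩
    let U : M2 := !![((√t : ℝ) : ℂ), -((√(1-t) : ℝ) : ℂ); ((√(1-t) : ℝ) : ℂ), ((√t : ℝ) : ℂ)]
    have s1 : ((√t : ℝ) : ℂ) * ((√t : ℝ) : ℂ) = t := by
      exact_mod_cast Real.mul_self_sqrt ht0
    have s2 : ((√(1-t) : ℝ) : ℂ) * ((√(1-t) : ℝ) : ℂ) = 1 - t := by
      exact_mod_cast Real.mul_self_sqrt (sub_nonneg.mpr ht1)
    have hU : memU2 U := by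
      unfold memU2
      ext i j
      fin_cases i <;> fin_cases j <;> simp [U, Matrix.mul_apply, Fin.sum_univ_two]
      · linear_combination s1 + s2
      · ring
      · ring
      · linear_combination s1 + s2
    have hU0 : Complex.normSq (U 0 0) = t := by
      simp [U, Complex.normSq_ofReal, Real.mul_self_sqrt ht0]
    have hB : memU2 (U * D2 β₁ β₂ * Uᴴ) := memU2_mul (memU2_mul hU (D2_memU2 _ _)) (memU2_star hU)
    have hAB := memU2_mul (D2_memU2 α₁ α₂) hB
    have htr : (D2 α₁ α₂ * (U * D2 β₁ β₂ * Uᴴ)).trace = (D2 (-γ₁) (-γ₂)).trace := by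
      have := trace_formula α₁ α₂ β₁ β₂ U hU
      rw [hU0, ht, ← D2_trace] at this
      rw [← this]
      simp only [Matrix.mul_assoc]
    refine ⟨D2 α₁ α₂, U * D2 β₁ β₂ * Uᴴ, (D2 α₁ α₂ * (U * D2 β₁ β₂ * Uᴴ))ᴴ,
      D2_memU2 _ _, hB, memU2_star hAB, ⟨1, by simp [memU2], by simp⟩,
      ⟨U, hU, by rw [memU2_inv hU]⟩, ?_, memU2_right hAB⟩
    apply conjU2_of_trace_det _ (memU2_star hAB)
    · rw [Matrix.trace_conjTranspose, htr, ← Matrix.trace_conjTranspose, D2_star, D2_trace]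
      simp
    · rw [Matrix.det_conjTranspose, Matrix.det_mul, conj_det _ _ hU, star_mul',
        ← Matrix.det_conjTranspose, ← Matrix.det_conjTranspose, D2_star, D2_star, D2_det, D2_det,
        ← Complex.exp_add, ← Complex.exp_add, ← mul_one (Complex.exp _), ← hS,
        ← Complex.exp_add]
      congr 1
      push_cast
      ring

lemma pair_exp (m x : ℝ) : Complex.exp ((m + x : ℝ) * Complex.I) +
    Complex.exp ((m - x : ℝ) * Complex.I) =
    Complex.exp (m * Complex.I) * ((2 * Real.cos x : ℝ) : ℂ) := by
  push_cast
  rw [Complex.two_cos, sub_mul, add_mul, sub_eq_add_neg, Complex.exp_add, Complex.exp_add, neg_mul]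
  ring

/-- `s = cos(nπ)`. -/
lemma traceCond_iff (α₁ α₂ β₁ β₂ γ₁ γ₂ t s M : ℝ)
    (hs : Complex.exp (M * Complex.I) = s)
    (hs2 : s * s = 1)
    (hM : α₁ + α₂ + β₁ + β₂ + γ₁ + γ₂ = 2 * M) :
    traceCond α₁ α₂ β₁ β₂ γ₁ γ₂ t ↔
      t * Real.cos ((α₁ - α₂) / 2 + (β₁ - β₂) / 2)
       + (1 - t) * Real.cos ((α₁ - α₂) / 2 - (β₁ - β₂) / 2) = s * Real.cos ((γ₁ - γ₂) / 2) := by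
  unfold traceCond
  have p1 := pair_exp ((α₁ + α₂ + β₁ + β₂) / 2) ((α₁ - α₂) / 2 + (β₁ - β₂) / 2)
  have p2 := pair_exp ((α₁ + α₂ + β₁ + β₂) / 2) ((α₁ - α₂) / 2 - (β₁ - β₂) / 2)
  have p3 := pair_exp (-(γ₁ + γ₂) / 2) (-((γ₁ - γ₂) / 2))
  rw [Real.cos_neg] at p3
  have p4 : Complex.exp ((-(γ₁ + γ₂) / 2 : ℝ) * Complex.I) * s =
      Complex.exp (((α₁ + α₂ + β₁ + β₂) / 2 : ℝ) * Complex.I) := by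
    rw [← hs, ← Complex.exp_add, ← add_mul, ← Complex.ofReal_add]
    congr 3
    linarith
  have hs2' : (s : ℂ) * s = 1 := by exact_mod_cast hs2
  have p5 : Complex.exp ((-(γ₁ + γ₂) / 2 : ℝ) * Complex.I) =
      Complex.exp (((α₁ + α₂ + β₁ + β₂) / 2 : ℝ) * Complex.I) * s := by
    rw [← p4, mul_assoc, hs2', mul_one]
  rw [p5] at p3
  have e1 : (α₁ + α₂ + β₁ + β₂) / 2 + ((α₁ - α₂) / 2 + (β₁ - β₂) / 2) = α₁ + β₁ := by ring
  have e2 : (α₁ + α₂ + β₁ + β₂) / 2 - ((α₁ - α₂) / 2 + (β₁ - β₂) / 2) = α₂ + β₂ := by ring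
  have e3 : (α₁ + α₂ + β₁ + β₂) / 2 + ((α₁ - α₂) / 2 - (β₁ - β₂) / 2) = α₁ + β₂ := by ring
  have e4 : (α₁ + α₂ + β₁ + β₂) / 2 - ((α₁ - α₂) / 2 - (β₁ - β₂) / 2) = α₂ + β₁ := by ring
  have e5 : -(γ₁ + γ₂) / 2 + -((γ₁ - γ₂) / 2) = -γ₁ := by ring
  have e6 : -(γ₁ + γ₂) / 2 - -((γ₁ - γ₂) / 2) = -γ₂ := by ring
  rw [e1, e2] at p1
  rw [e3, e4] at p2
  rw [e5, e6] at p3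
  rw [p1, p2, p3]
  have hne : Complex.exp (((α₁ + α₂ + β₁ + β₂) / 2 : ℝ) * Complex.I) * 2 ≠ 0 :=
    mul_ne_zero (Complex.exp_ne_zero _) two_ne_zero
  rw [← Complex.ofReal_inj]
  conv_rhs => rw [← mul_right_inj' hne]
  push_cast
  constructor <;> intro h <;> linear_combination h

lemma exists_t_iff (x y z : ℝ) (hxy : x ≤ y) :
    (∃ t : ℝ, 0 ≤ t ∧ t ≤ 1 ∧ t * x + (1 - t) * y = z) ↔ x ≤ z ∧ z ≤ y := by
  constructor
  · rintro ⟨t, h0, h1, rfl⟩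
    constructor <;> nlinarith
  · rintro ⟨h1, h2⟩
    rcases hxy.eq_or_lt with h | h
    · exact ⟨0, le_rfl, zero_le_one, by linarith⟩
    · have : 0 < y - x := by linarith
      refine ⟨(y - z) / (y - x), by apply div_nonneg <;> linarith, ?_, ?_⟩
      · rw [div_le_one this]; linarith
      · field_simp
        ring

lemma cos_range_iff (a b c : ℝ) (ha : 0 ≤ a) (ha' : a ≤ π) (hb : 0 ≤ b) (hb' : b ≤ π)
    (hc : 0 ≤ c) (hc' : c ≤ π) :
    (Real.cos (a + b) ≤ Real.cos c ∧ Real.cos c ≤ Real.cos (a - b)) ↔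
      (c ≤ a + b ∧ a + b + c ≤ 2 * π ∧ a - b ≤ c ∧ b - a ≤ c) := by
  have k1 : Real.cos c ≤ Real.cos (a - b) ↔ |a - b| ≤ c := by
    rw [← Real.cos_abs (a - b)]
    exact Real.strictAntiOn_cos.le_iff_ge ⟨hc, hc'⟩
      ⟨abs_nonneg _, abs_le.mpr ⟨by linarith, by linarith⟩⟩
  have k2 : Real.cos (a + b) ≤ Real.cos c ↔ c ≤ a + b ∧ a + b + c ≤ 2 * π := by
    rcases le_total (a + b) π with h | h
    · rw [Real.strictAntiOn_cos.le_iff_ge ⟨by linarith, h⟩ ⟨hc, hc'⟩]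
      constructor
      · intro h; exact ⟨h, by linarith⟩
      · exact fun h => h.1
    · rw [← Real.cos_two_pi_sub, Real.strictAntiOn_cos.le_iff_ge ⟨by linarith, by linarith⟩ ⟨hc, hc'⟩]
      constructor
      · intro h; exact ⟨by linarith, by linarith⟩
      · intro h; linarith
  rw [k1, k2, abs_le]
  constructor
  · rintro ⟨⟨h1, h2⟩, h3, h4⟩; exact ⟨h1, h2, h4, by linarith⟩
  · rintro ⟨h1, h2, h3, h4⟩; exact ⟨⟨h1, h2⟩, by linarith, h3⟩

lemma scalar_iff (α₁ α₂ β₁ β₂ γ₁ γ₂ s M : ℝ)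
    (hτ : memT3 ((α₁, α₂), (β₁, β₂), (γ₁, γ₂)))
    (hs : Complex.exp (M * Complex.I) = s) (hs2 : s * s = 1)
    (hM : α₁ + α₂ + β₁ + β₂ + γ₁ + γ₂ = 2 * M) (c : ℝ) (hc : 0 ≤ c) (hc' : c ≤ π)
    (hcos : s * Real.cos ((γ₁ - γ₂) / 2) = Real.cos c) :
    (∃ A B C : M2, memU2 A ∧ memU2 B ∧ memU2 C ∧
        conjU2 A α₁ α₂ ∧ conjU2 B β₁ β₂ ∧ conjU2 C γ₁ γ₂ ∧ A * B * C = 1) ↔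
      (c ≤ (α₁ - α₂) / 2 + (β₁ - β₂) / 2 ∧ (α₁ - α₂) / 2 + (β₁ - β₂) / 2 + c ≤ 2 * π ∧
        (α₁ - α₂) / 2 - (β₁ - β₂) / 2 ≤ c ∧ (β₁ - β₂) / 2 - (α₁ - α₂) / 2 ≤ c) := by
  obtain ⟨⟨a1, a2, a3, a4, a5⟩, ⟨b1, b2, b3, b4, b5⟩, -⟩ := hτ
  simp only at a1 a2 a3 a4 a5 b1 b2 b3 b4 b5
  rw [horn_scalar_iff, ← cos_range_iff _ _ c (by linarith) (by linarith) (by linarith) (by linarith)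
    hc hc', ← hcos, ← exists_t_iff]
  · simp only [traceCond_iff α₁ α₂ β₁ β₂ γ₁ γ₂ _ s M hs hs2 hM]
    have : Complex.exp ((α₁ + α₂ + β₁ + β₂ + γ₁ + γ₂ : ℝ) * Complex.I) = 1 := by
      rw [hM, show ((2 * M : ℝ) : ℂ) * Complex.I = M * Complex.I + M * Complex.I by
        push_cast; ring, Complex.exp_add, hs]
      exact_mod_cast hs2
    simp only [this, true_and]
  · rw [Real.cos_add, Real.cos_sub]
    have := Real.sin_nonneg_of_nonneg_of_le_pi (x := (α₁ - α₂) / 2) (by linarith) (by linarith)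
    have := Real.sin_nonneg_of_nonneg_of_le_pi (x := (β₁ - β₂) / 2) (by linarith) (by linarith)
    nlinarith [mul_nonneg ‹0 ≤ Real.sin ((α₁ - α₂) / 2)› this]

lemma even_iff (α₁ α₂ β₁ β₂ γ₁ γ₂ : ℝ) (k : ℕ)
    (hτ : memT3 ((α₁, α₂), (β₁, β₂), (γ₁, γ₂)))
    (hM : α₁ + α₂ + β₁ + β₂ + γ₁ + γ₂ = 2 * (k * (2 * π))) :
    (∃ A B C : M2, memU2 A ∧ memU2 B ∧ memU2 C ∧
        conjU2 A α₁ α₂ ∧ conjU2 B β₁ β₂ ∧ conjU2 C γ₁ γ₂ ∧ A * B * C = 1) ↔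
      ((γ₁ - γ₂) / 2 ≤ (α₁ - α₂) / 2 + (β₁ - β₂) / 2 ∧
        (α₁ - α₂) / 2 + (β₁ - β₂) / 2 + (γ₁ - γ₂) / 2 ≤ 2 * π ∧
        (α₁ - α₂) / 2 - (β₁ - β₂) / 2 ≤ (γ₁ - γ₂) / 2 ∧
        (β₁ - β₂) / 2 - (α₁ - α₂) / 2 ≤ (γ₁ - γ₂) / 2) := by
  obtain ⟨c1, c2, c3, c4, c5⟩ := hτ.2.2
  simp only at c1 c2 c3 c4 c5
  refine scalar_iff α₁ α₂ β₁ β₂ γ₁ γ₂ 1 (k * (2 * π)) hτ ?_ (by norm_num) hM _ (by linarith)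
    (by linarith) (by rw [one_mul])
  have := Complex.exp_nat_mul_two_pi_mul_I k
  rw [Complex.ofReal_one, ← this]
  congr 1
  push_cast
  ring

lemma odd_iff (α₁ α₂ β₁ β₂ γ₁ γ₂ : ℝ) (k : ℕ)
    (hτ : memT3 ((α₁, α₂), (β₁, β₂), (γ₁, γ₂)))
    (hM : α₁ + α₂ + β₁ + β₂ + γ₁ + γ₂ = 2 * (k * (2 * π) + π)) :
    (∃ A B C : M2, memU2 A ∧ memU2 B ∧ memU2 C ∧
        conjU2 A α₁ α₂ ∧ conjU2 B β₁ β₂ ∧ conjU2 C γ₁ γ₂ ∧ A * B * C = 1) ↔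
      (π - (γ₁ - γ₂) / 2 ≤ (α₁ - α₂) / 2 + (β₁ - β₂) / 2 ∧
        (α₁ - α₂) / 2 + (β₁ - β₂) / 2 + (π - (γ₁ - γ₂) / 2) ≤ 2 * π ∧
        (α₁ - α₂) / 2 - (β₁ - β₂) / 2 ≤ π - (γ₁ - γ₂) / 2 ∧
        (β₁ - β₂) / 2 - (α₁ - α₂) / 2 ≤ π - (γ₁ - γ₂) / 2) := by
  obtain ⟨c1, c2, c3, c4, c5⟩ := hτ.2.2
  simp only at c1 c2 c3 c4 c5
  refine scalar_iff α₁ α₂ β₁ β₂ γ₁ γ₂ (-1) (k * (2 * π) + π) hτ ?_ (by norm_num) hM _ (by linarith)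
    (by linarith) (by rw [Real.cos_pi_sub]; ring)
  have := Complex.exp_nat_mul_two_pi_mul_I k
  rw [show ((k * (2 * π) + π : ℝ) : ℂ) * Complex.I = k * (2 * π * Complex.I) + π * Complex.I by
    push_cast; ring, Complex.exp_add, this, Complex.exp_pi_mul_I]
  simp

/-- Multiplicative Horn problem in U(2). -/
theorem horn_U2 (α₁ α₂ β₁ β₂ γ₁ γ₂ : ℝ)
    (hτ : memT3 ((α₁, α₂), (β₁, β₂), (γ₁, γ₂))) :
    (∃ A B C : M2, memU2 A ∧ memU2 B ∧ memU2 C ∧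
        conjU2 A α₁ α₂ ∧ conjU2 B β₁ β₂ ∧ conjU2 C γ₁ γ₂ ∧ A * B * C = 1) ↔
      ((α₁ + α₂ + β₁ + β₂ + γ₁ + γ₂ = 0) ∨
      (α₁ + α₂ + β₁ + β₂ + γ₁ + γ₂ = 2 * π ∧ α₂ + β₂ + γ₂ ≤ 0 ∧
        α₁ + β₁ + γ₂ ≤ 2 * π ∧ α₁ + β₂ + γ₁ ≤ 2 * π ∧ α₂ + β₁ + γ₁ ≤ 2 * π) ∨
      (α₁ + α₂ + β₁ + β₂ + γ₁ + γ₂ = 4 * π ∧ α₁ + β₁ + γ₁ ≤ 4 * π ∧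
        α₁ + β₂ + γ₂ ≤ 2 * π ∧ α₂ + β₁ + γ₂ ≤ 2 * π ∧ α₂ + β₂ + γ₁ ≤ 2 * π) ∨
      (α₁ + α₂ + β₁ + β₂ + γ₁ + γ₂ = 6 * π ∧ α₂ + β₂ + γ₂ ≤ 2 * π ∧
        α₁ + β₁ + γ₂ ≤ 4 * π ∧ α₁ + β₂ + γ₁ ≤ 4 * π ∧ α₂ + β₁ + γ₁ ≤ 4 * π) ∨
      (α₁ + α₂ + β₁ + β₂ + γ₁ + γ₂ = 8 * π ∧ α₁ + β₁ + γ₁ ≤ 6 * π ∧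
        α₁ + β₂ + γ₂ ≤ 4 * π ∧ α₂ + β₁ + γ₂ ≤ 4 * π ∧ α₂ + β₂ + γ₁ ≤ 4 * π)) := by
  have hτ' := hτ
  obtain ⟨⟨a1, a2, a3, a4, a5⟩, ⟨b1, b2, b3, b4, b5⟩, ⟨c1, c2, c3, c4, c5⟩⟩ := hτ'
  simp only at a1 a2 a3 a4 a5 b1 b2 b3 b4 b5 c1 c2 c3 c4 c5
  have hpi := Real.pi_pos
  constructor
  · intro h
    obtain ⟨hS, -⟩ := (horn_scalar_iff _ _ _ _ _ _).mp h
    rw [Complex.exp_eq_one_iff] at hS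
    obtain ⟨n, hn⟩ := hS
    have hn' : α₁ + α₂ + β₁ + β₂ + γ₁ + γ₂ = n * (2 * π) := by
      have h1 : ((α₁ + α₂ + β₁ + β₂ + γ₁ + γ₂ : ℝ) : ℂ) * Complex.I
          = ((n * (2 * π) : ℝ) : ℂ) * Complex.I := by
        rw [hn]; push_cast; ring
      exact_mod_cast mul_right_cancel₀ Complex.I_ne_zero h1
    have n0 : (-1 : ℝ) < n := by
      by_contra hcon
      push Not at hcon
      nlinarith
    have n6 : (n : ℝ) < 6 := by
      by_contra hcon
      push Not at hcon
      nlinarith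
    have n0' : -1 < n := by exact_mod_cast n0
    have n6' : n < 6 := by exact_mod_cast n6
    interval_cases n
    · left
      rw [hn']; simp
    · have := (odd_iff _ _ _ _ _ _ 0 hτ (by rw [hn']; push_cast; ring)).mp h
      obtain ⟨h1, h2, h3, h4⟩ := this
      push_cast at hn'
      right; left
      refine ⟨?_, ?_, ?_, ?_, ?_⟩ <;> linarith
    · have := (even_iff _ _ _ _ _ _ 1 hτ (by rw [hn']; push_cast; ring)).mp h
      obtain ⟨h1, h2, h3, h4⟩ := this
      push_cast at hn'
      right; right; left
      refine ⟨?_, ?_, ?_, ?_, ?_⟩ <;> linarith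
    · have := (odd_iff _ _ _ _ _ _ 1 hτ (by rw [hn']; push_cast; ring)).mp h
      obtain ⟨h1, h2, h3, h4⟩ := this
      push_cast at hn'
      right; right; right; left
      refine ⟨?_, ?_, ?_, ?_, ?_⟩ <;> linarith
    · have := (even_iff _ _ _ _ _ _ 2 hτ (by rw [hn']; push_cast; ring)).mp h
      obtain ⟨h1, h2, h3, h4⟩ := this
      push_cast at hn'
      right; right; right; right
      refine ⟨?_, ?_, ?_, ?_, ?_⟩ <;> linarith
    · have := (odd_iff _ _ _ _ _ _ 2 hτ (by rw [hn']; push_cast; ring)).mp h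
      obtain ⟨h1, h2, h3, h4⟩ := this
      push_cast at hn'
      exfalso
      linarith
  · rintro (h | ⟨h, h1, h2, h3, h4⟩ | ⟨h, h1, h2, h3, h4⟩ | ⟨h, h1, h2, h3, h4⟩ |
      ⟨h, h1, h2, h3, h4⟩)
    · rw [even_iff _ _ _ _ _ _ 0 hτ (by rw [h]; simp)]
      refine ⟨?_, ?_, ?_, ?_⟩ <;> linarith
    · rw [odd_iff _ _ _ _ _ _ 0 hτ (by rw [h]; push_cast; ring)]
      refine ⟨?_, ?_, ?_, ?_⟩ <;> linarith
    · rw [even_iff _ _ _ _ _ _ 1 hτ (by rw [h]; push_cast; ring)]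
      refine ⟨?_, ?_, ?_, ?_⟩ <;> linarith
    · rw [odd_iff _ _ _ _ _ _ 1 hτ (by rw [h]; push_cast; ring)]
      refine ⟨?_, ?_, ?_, ?_⟩ <;> linarith
    · rw [even_iff _ _ _ _ _ _ 2 hτ (by rw [h]; push_cast; ring)]
      refine ⟨?_, ?_, ?_, ?_⟩ <;> linarith
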